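/- Let P be a d-dimensional polytope. Then the extension complexity of P equals d+1 if and only if P is a d-simplex (the convex hull of d+1 affinely independent points). -/

import Mathlib

open Set

noncomputable section

/-- A polytope: the convex hull of a finite set of points. -/
def IsPolytope {N : ℕ} (P : Set (Fin N → ℝ)) : Prop :=
  ∃ S : Finset (Fin N → ℝ), P = convexHull ℝ (S : Set (Fin N → ℝ))

/-- Dimension of a set: the dimension of its affine hull (with `-1` for the empty set). -/
def pdim {N : ℕ} (P : Set (Fin N → ℝ)) : ℤ :=
  haveI := Classical.dec P.Nonempty
  if P.Nonempty then (Module.finrank ℝ (affineSpan ℝ P).direction : ℤ) else -1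

/-- `F` is a face of `P`: the subset of `P` where some linear functional bounded above on `P`
attains its maximum value.  This includes `∅` and `P` itself. -/
def IsFaceOf {N : ℕ} (F P : Set (Fin N → ℝ)) : Prop :=
  ∃ (c : Fin N → ℝ) (b : ℝ),
    (∀ x ∈ P, ∑ i, c i * x i ≤ b) ∧ F = {x ∈ P | ∑ i, c i * x i = b}

/-- A facet: a face of dimension one less than the polytope. -/
def IsFacetOf {N : ℕ} (F P : Set (Fin N → ℝ)) : Prop :=
  IsFaceOf F P ∧ pdim F + 1 = pdim P

/-- A ridge: a face of dimension two less than the polytope. -/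
def IsRidgeOf {N : ℕ} (F P : Set (Fin N → ℝ)) : Prop :=
  IsFaceOf F P ∧ pdim F + 2 = pdim P

def IsVertexOf {N : ℕ} (v : Fin N → ℝ) (P : Set (Fin N → ℝ)) : Prop :=
  IsFaceOf {v} P

def vertexSet {N : ℕ} (P : Set (Fin N → ℝ)) : Set (Fin N → ℝ) :=
  {v | IsVertexOf v P}

def vertexCount {N : ℕ} (P : Set (Fin N → ℝ)) : ℕ := (vertexSet P).ncard

def facetCount {N : ℕ} (P : Set (Fin N → ℝ)) : ℕ := {F | IsFacetOf F P}.ncard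

/-- Extension complexity: the minimal number of facets of a polytope (in any dimension)
admitting an affine projection onto `P`. -/
def xc {N : ℕ} (P : Set (Fin N → ℝ)) : ℕ :=
  sInf {n | ∃ (e : ℕ) (Q : Set (Fin e → ℝ)) (π : (Fin e → ℝ) →ᵃ[ℝ] (Fin N → ℝ)),
    IsPolytope Q ∧ π '' Q = P ∧ facetCount Q = n}

/-- Combinatorial equivalence: an inclusion-preserving bijection between face lattices. -/
def CombEquiv {M N : ℕ} (P : Set (Fin M → ℝ)) (Q : Set (Fin N → ℝ)) : Prop :=
  ∃ φ : {F : Set (Fin M → ℝ) // IsFaceOf F P} ≃ {G : Set (Fin N → ℝ) // IsFaceOf G Q},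
    ∀ F₁ F₂ : {F : Set (Fin M → ℝ) // IsFaceOf F P},
      F₁.1 ⊆ F₂.1 ↔ (φ F₁).1 ⊆ (φ F₂).1

/-- A full-dimensional `n`-simplex in `ℝ^n` with the origin in its (relative) interior. -/
def simplexF (n : ℕ) : Set (Fin n → ℝ) :=
  convexHull ℝ ((Set.range fun i : Fin n => Pi.single i (1 : ℝ)) ∪ {fun _ => -1})

/-- The Cartesian product `Δ_n × Δ_m`, realized in `ℝ^{n+m}`. -/
def prodP (n m : ℕ) : Set (Fin (n + m) → ℝ) :=
  {z | ∃ a ∈ simplexF n, ∃ b ∈ simplexF m, z = Fin.append a b}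

/-- The direct sum `Δ_n ⊕ Δ_m`, realized in `ℝ^{n+m}`. -/
def sumP (n m : ℕ) : Set (Fin (n + m) → ℝ) :=
  convexHull ℝ (((fun a : Fin n → ℝ => Fin.append a (0 : Fin m → ℝ)) '' simplexF n) ∪
    ((fun b : Fin m → ℝ => Fin.append (0 : Fin n → ℝ) b) '' simplexF m))

/-- The join `A ⋆ B` of two polytopes, realized in `ℝ^{p+q+1}` with the two copies
placed in skew affine subspaces. -/
def joinP {p q : ℕ} (A : Set (Fin p → ℝ)) (B : Set (Fin q → ℝ)) :
    Set (Fin (p + q + 1) → ℝ) :=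
  convexHull ℝ
    (((fun a : Fin p → ℝ =>
        Fin.append (Fin.append a (0 : Fin q → ℝ)) (fun _ : Fin 1 => (0 : ℝ))) '' A) ∪
     ((fun b : Fin q → ℝ =>
        Fin.append (Fin.append (0 : Fin p → ℝ) b) (fun _ : Fin 1 => (1 : ℝ))) '' B))

/-- The canonical `k`-fold iterated pyramid over `X`, realized in `ℝ^{p+k}`. -/
def pyrK {p : ℕ} (k : ℕ) (X : Set (Fin p → ℝ)) : Set (Fin (p + k) → ℝ) :=
  convexHull ℝ (((fun x : Fin p → ℝ => Fin.append x (0 : Fin k → ℝ)) '' X) ∪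
    Set.range (fun j : Fin k => Fin.append (0 : Fin p → ℝ) (Pi.single j (1 : ℝ))))

/-- Transport a subset of `ℝ^a` to `ℝ^b` along a proof that `a = b`. -/
def castSet {a b : ℕ} (h : a = b) (X : Set (Fin a → ℝ)) : Set (Fin b → ℝ) :=
  (fun x : Fin a → ℝ => fun i : Fin b => x (Fin.cast h.symm i)) '' X

/-- Projective equivalence of two subsets of `ℝ^N`: `Q` is the image of `P` under a
projective transformation `x ↦ (A x + b) / (⟨c, x⟩ + δ)` whose associated
`(N+1) × (N+1)` matrix is invertible and whose denominator is positive on `P`. -/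
def ProjEquiv {N : ℕ} (P Q : Set (Fin N → ℝ)) : Prop :=
  ∃ (A : (Fin N → ℝ) →ₗ[ℝ] (Fin N → ℝ)) (b c : Fin N → ℝ) (δ : ℝ),
    Function.Bijective
      (fun z : (Fin N → ℝ) × ℝ => (A z.1 + z.2 • b, (∑ i, c i * z.1 i) + δ * z.2)) ∧
    (∀ x ∈ P, 0 < (∑ i, c i * x i) + δ) ∧
    Q = (fun x : Fin N → ℝ => ((∑ i, c i * x i) + δ)⁻¹ • (A x + b)) '' P

/-- `P` is a pyramid with base `B`: the convex hull of `B` and a point outside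
the affine hull of `B`. -/
def IsPyramidOver {N : ℕ} (P B : Set (Fin N → ℝ)) : Prop :=
  ∃ a : Fin N → ℝ, a ∉ affineSpan ℝ B ∧ P = convexHull ℝ (B ∪ {a})

/-- `P` is a `k`-fold iterated pyramid over `B`. -/
def IsKFoldPyramidOver {N : ℕ} : ℕ → Set (Fin N → ℝ) → Set (Fin N → ℝ) → Prop
  | 0, P, B => P = B
  | k + 1, P, B => ∃ P' : Set (Fin N → ℝ), IsPyramidOver P P' ∧ IsKFoldPyramidOver k P' B

/-- `P` is a pyramid: the convex hull of one of its facets together with one more vertex. -/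
def IsPyramidPolytope {N : ℕ} (P : Set (Fin N → ℝ)) : Prop :=
  ∃ (F : Set (Fin N → ℝ)) (v : Fin N → ℝ),
    IsFacetOf F P ∧ IsVertexOf v P ∧ P = convexHull ℝ (F ∪ {v})

/-- A facet is pyramidal if it contains all vertices of the polytope but one. -/
def IsPyramidalFacet {N : ℕ} (F P : Set (Fin N → ℝ)) : Prop :=
  IsFacetOf F P ∧ ∃ v, IsVertexOf v P ∧ v ∉ F ∧ ∀ w, IsVertexOf w P → w ≠ v → w ∈ F

/-- The projection `π_d : ℝ^{d+1} → ℝ^d` forgetting the last coordinate. -/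
def projFun (d : ℕ) : (Fin (d + 1) → ℝ) → (Fin d → ℝ) :=
  fun x i => x i.castSucc

/-- `c` is an outer normal vector exposing the face `F` of `Q`. -/
def IsOuterNormal {N : ℕ} (Q F : Set (Fin N → ℝ)) (c : Fin N → ℝ) : Prop :=
  ∃ b : ℝ, (∀ x ∈ Q, ∑ i, c i * x i ≤ b) ∧ F = {x ∈ Q | ∑ i, c i * x i = b}

/-- An upper facet: outer normal with positive last coordinate. -/
def IsUpperFacet {d : ℕ} (F Q : Set (Fin (d + 1) → ℝ)) : Prop :=
  IsFacetOf F Q ∧ ∃ c, IsOuterNormal Q F c ∧ 0 < c (Fin.last d)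

/-- A lower facet: outer normal with negative last coordinate. -/
def IsLowerFacet {d : ℕ} (F Q : Set (Fin (d + 1) → ℝ)) : Prop :=
  IsFacetOf F Q ∧ ∃ c, IsOuterNormal Q F c ∧ c (Fin.last d) < 0

/-- A vertical facet: every outer normal has vanishing last coordinate. -/
def IsVerticalFacet {d : ℕ} (F Q : Set (Fin (d + 1) → ℝ)) : Prop :=
  IsFacetOf F Q ∧ ∀ c, IsOuterNormal Q F c → c (Fin.last d) = 0

/-- An equatorial ridge: a ridge that is the intersection of an upper and a lower facet. -/
def IsEquatorialRidge {d : ℕ} (F Q : Set (Fin (d + 1) → ℝ)) : Prop :=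
  IsRidgeOf F Q ∧ ∃ F₁ F₂ : Set (Fin (d + 1) → ℝ),
    IsUpperFacet F₁ Q ∧ IsLowerFacet F₂ Q ∧ F = F₁ ∩ F₂

/-- A face `F` of `Q` is preserved under the projection forgetting the last coordinate. -/
def PreservedFace {d : ℕ} (Q F : Set (Fin (d + 1) → ℝ)) : Prop :=
  IsFaceOf (projFun d '' F) (projFun d '' Q) ∧ projFun d ⁻¹' (projFun d '' F) ∩ Q = F

/-- A face `F` of `Q` is strictly preserved: preserved and of the same dimension as its image. -/
def StrictlyPreservedFace {d : ℕ} (Q F : Set (Fin (d + 1) → ℝ)) : Prop :=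
  PreservedFace Q F ∧ pdim (projFun d '' F) = pdim F

/-- A hexagon: a 2-dimensional polytope with exactly 6 vertices. -/
def IsHexagon {N : ℕ} (P : Set (Fin N → ℝ)) : Prop :=
  IsPolytope P ∧ pdim P = 2 ∧ vertexCount P = 6

/-- Three lines are concurrent: they share a common point, or they are pairwise parallel. -/
def ConcurrentLines {N : ℕ} (L₁ L₂ L₃ : AffineSubspace ℝ (Fin N → ℝ)) : Prop :=
  (∃ x, x ∈ L₁ ∧ x ∈ L₂ ∧ x ∈ L₃) ∨
    (AffineSubspace.Parallel L₁ L₂ ∧ AffineSubspace.Parallel L₂ L₃ ∧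
      AffineSubspace.Parallel L₁ L₃)

/-- A cyclic labeling of the vertices of a hexagon: consecutive points are joined by edges. -/
def CyclicLabeling {N : ℕ} (P : Set (Fin N → ℝ)) (p : Fin 6 → (Fin N → ℝ)) : Prop :=
  Function.Injective p ∧ Set.range p = vertexSet P ∧
    ∀ i : Fin 6, IsFaceOf (segment ℝ (p i) (p (i + 1))) P

/-- A Desarguian hexagon. -/
def Desarguian {N : ℕ} (P : Set (Fin N → ℝ)) : Prop :=
  ∃ p : Fin 6 → (Fin N → ℝ), CyclicLabeling P p ∧
    ConcurrentLines (affineSpan ℝ {p 0, p 1}) (affineSpan ℝ {p 5, p 2})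
      (affineSpan ℝ {p 3, p 4})

/-- A polytope is simplicial if every facet is a simplex. -/
def IsSimplicial {N : ℕ} (P : Set (Fin N → ℝ)) : Prop :=
  ∀ F : Set (Fin N → ℝ), IsFacetOf F P →
    ∃ S : Finset (Fin N → ℝ),
      AffineIndependent ℝ (Subtype.val : {x // x ∈ S} → (Fin N → ℝ)) ∧
      F = convexHull ℝ (S : Set (Fin N → ℝ))

/-- The lift of a point to height one, turning affine statements into linear ones. -/
def homogenize {N : ℕ} (x : Fin N → ℝ) : (Fin N → ℝ) × ℝ := (x, 1)

lemma homogenize_combo {N : ℕ} (x y : Fin N → ℝ) {a b : ℝ} (hab : a + b = 1) :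
    homogenize (a • x + b • y) = a • homogenize x + b • homogenize y := by
  ext <;> simp [homogenize, hab]

lemma homogenize_sum {N : ℕ} {ι : Type*} [Fintype ι] (w : ι → ℝ) (hw : ∑ i, w i = 1)
    (z : ι → Fin N → ℝ) :
    homogenize (∑ i, w i • z i) = ∑ i, w i • homogenize (z i) := by
  apply Prod.ext
  · simp [homogenize, Prod.fst_sum]
  · simp [homogenize, Prod.snd_sum, hw]

lemma span_homogenize_convexHull {N : ℕ} (S : Set (Fin N → ℝ)) :
    Submodule.span ℝ (homogenize '' convexHull ℝ S) = Submodule.span ℝ (homogenize '' S) := by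
  apply le_antisymm
  · rw [Submodule.span_le, image_subset_iff]
    refine convexHull_min (fun x hx => Submodule.subset_span (mem_image_of_mem _ hx)) ?_
    intro x hx y hy a b _ _ hab
    simp only [mem_preimage, SetLike.mem_coe] at hx hy ⊢
    rw [homogenize_combo x y hab]
    exact add_mem (Submodule.smul_mem _ _ hx) (Submodule.smul_mem _ _ hy)
  · exact Submodule.span_mono (image_mono (subset_convexHull ℝ S))

/-- The dimension of a set is one less than the linear dimension of its homogenization. -/
lemma pdim_add_one {N : ℕ} (Q : Set (Fin N → ℝ)) :
    pdim Q + 1 = Module.finrank ℝ (Submodule.span ℝ (homogenize '' Q)) := by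
  unfold pdim
  rcases Q.eq_empty_or_nonempty with rfl | ⟨q, hq⟩
  · rw [image_empty, Submodule.span_empty, finrank_bot]
    simp
  rw [if_pos ⟨q, hq⟩, direction_affineSpan]
  set U := (vectorSpan ℝ Q).map (LinearMap.inl ℝ (Fin N → ℝ) ℝ) with hU
  have hspan : Submodule.span ℝ (homogenize '' Q) = U ⊔ ℝ ∙ homogenize q := by
    apply le_antisymm
    · rw [Submodule.span_le]
      rintro _ ⟨x, hx, rfl⟩
      have : homogenize x = LinearMap.inl ℝ (Fin N → ℝ) ℝ (x -ᵥ q) + homogenize q := by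
        ext <;> simp [homogenize]
      rw [this]
      exact Submodule.add_mem_sup (Submodule.mem_map_of_mem (vsub_mem_vectorSpan ℝ hx hq))
        (Submodule.mem_span_singleton_self _)
    · refine sup_le ?_ ?_
      · rw [hU, vectorSpan_eq_span_vsub_set_right ℝ hq, Submodule.map_span, Submodule.span_le]
        rintro _ ⟨_, ⟨x, hx, rfl⟩, rfl⟩
        have : LinearMap.inl ℝ (Fin N → ℝ) ℝ (x -ᵥ q) = homogenize x - homogenize q := by
          ext <;> simp [homogenize]
        change LinearMap.inl ℝ (Fin N → ℝ) ℝ (x -ᵥ q) ∈ _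
        rw [this]
        exact sub_mem (Submodule.subset_span (mem_image_of_mem _ hx))
          (Submodule.subset_span (mem_image_of_mem _ hq))
      · rw [Submodule.span_singleton_le_iff_mem]
        exact Submodule.subset_span (mem_image_of_mem _ hq)
  have hinf : U ⊓ ℝ ∙ homogenize q = ⊥ := by
    rw [eq_bot_iff]
    rintro x ⟨⟨y, -, hy⟩, hx⟩
    obtain ⟨a, rfl⟩ := Submodule.mem_span_singleton.1 hx
    have h2 := congrArg Prod.snd hy
    have ha : a = 0 := by simpa [homogenize] using h2.symm
    simp [ha]
  have hsum := Submodule.finrank_sup_add_finrank_inf_eq U (ℝ ∙ homogenize q)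
  have hne : homogenize q ≠ 0 := fun h => by simpa [homogenize] using congrArg Prod.snd h
  have hmap : Module.finrank ℝ U = Module.finrank ℝ (vectorSpan ℝ Q) :=
    (LinearEquiv.finrank_eq (Submodule.equivMapOfInjective _ LinearMap.inl_injective _)).symm
  rw [hinf, finrank_bot, finrank_span_singleton hne, hmap] at hsum
  rw [hspan]
  omega

lemma isFacetOf_iff {N : ℕ} {F Q : Set (Fin N → ℝ)} :
    IsFacetOf F Q ↔ IsFaceOf F Q ∧
      Module.finrank ℝ (Submodule.span ℝ (homogenize '' F)) + 1 =
        Module.finrank ℝ (Submodule.span ℝ (homogenize '' Q)) := by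
  have hF := pdim_add_one F
  have hQ := pdim_add_one Q
  unfold IsFacetOf
  refine and_congr_right fun _ => ⟨fun h => ?_, fun h => ?_⟩ <;> omega

/-- Faces are the zero sets of linear functionals nonnegative on the homogenization. -/
lemma isFaceOf_iff {N : ℕ} {F Q : Set (Fin N → ℝ)} :
    IsFaceOf F Q ↔ ∃ f : Module.Dual ℝ ((Fin N → ℝ) × ℝ),
      (∀ x ∈ Q, 0 ≤ f (homogenize x)) ∧ F = {x ∈ Q | f (homogenize x) = 0} := by
  constructor
  · rintro ⟨c, b, hb, rfl⟩
    set f := b • LinearMap.snd ℝ (Fin N → ℝ) ℝ -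
      (dotProductBilin ℝ ℝ c).comp (LinearMap.fst ℝ (Fin N → ℝ) ℝ) with hf
    have key : ∀ x, f (homogenize x) = b - ∑ i, c i * x i := by
      intro x
      simp [hf, homogenize, dotProduct]
    refine ⟨f, fun x hx => ?_, ?_⟩
    · rw [key]
      linarith [hb x hx]
    · ext x
      simp only [mem_sep_iff, key]
      refine and_congr_right fun _ => ⟨fun h => ?_, fun h => ?_⟩ <;> linarith
  · rintro ⟨f, hf, rfl⟩
    have key : ∀ x, f (homogenize x) = f (0, 1) - ∑ i, -f (Pi.single i 1, 0) * x i := by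
      intro x
      have h : homogenize x = LinearMap.inl ℝ (Fin N → ℝ) ℝ x + (0, 1) := by
        ext <;> simp [homogenize]
      have h2 := (f ∘ₗ LinearMap.inl ℝ (Fin N → ℝ) ℝ).pi_apply_eq_sum_univ x
      have e : ∀ i : Fin N, (fun j => if i = j then (1 : ℝ) else 0) = Pi.single i 1 := by
        intro i
        ext j
        simp [Pi.single_apply, eq_comm]
      simp only [LinearMap.comp_apply, e] at h2
      rw [h, map_add, h2]
      simp [mul_comm, add_comm]
    refine ⟨fun i => -f (Pi.single i 1, 0), f (0, 1), fun x hx => ?_, ?_⟩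
    · have := hf x hx
      rw [key] at this
      linarith
    · ext x
      simp only [mem_sep_iff, key]
      refine and_congr_right fun _ => ⟨fun h => ?_, fun h => ?_⟩ <;> linarith

/-- A face of a convex hull is the convex hull of the generators it contains. -/
lemma IsFaceOf.eq_convexHull_inter {N : ℕ} {F S : Set (Fin N → ℝ)}
    (hF : IsFaceOf F (convexHull ℝ S)) : F = convexHull ℝ (F ∩ S) := by
  obtain ⟨f, hf, rfl⟩ := isFaceOf_iff.1 hF
  apply Subset.antisymm
  · rintro x ⟨hx, hfx⟩
    obtain ⟨ι, _, w, z, hw, hw1, hz, rfl⟩ := mem_convexHull_iff_exists_fintype.1 hx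
    rw [homogenize_sum w hw1, map_sum] at hfx
    simp only [map_smul, smul_eq_mul] at hfx
    have h0 := (Finset.sum_eq_zero_iff_of_nonneg fun i _ =>
      mul_nonneg (hw i) (hf _ (subset_convexHull ℝ S (hz i)))).1 hfx
    rw [← Finset.sum_subset (Finset.filter_subset (fun i => w i ≠ 0) Finset.univ)
      (by simp +contextual)]
    refine (convex_convexHull ℝ _).sum_mem (fun i _ => hw i) ?_ ?_
    · rw [← hw1]
      exact Finset.sum_filter_ne_zero _
    · intro i hi
      have hi0 : w i ≠ 0 := (Finset.mem_filter.1 hi).2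
      refine subset_convexHull ℝ _ ⟨⟨subset_convexHull ℝ S (hz i), ?_⟩, hz i⟩
      exact (mul_eq_zero.1 (h0 i (Finset.mem_univ i))).resolve_left hi0
  · refine convexHull_min inter_subset_left ?_
    intro x hx y hy a b ha hb hab
    refine ⟨convex_convexHull ℝ S hx.1 hy.1 ha hb hab, ?_⟩
    rw [homogenize_combo x y hab, map_add, map_smul, map_smul, hx.2, hy.2]
    simp

/-- A functional nonnegative on a finite set and negative at `x` can be rotated until its zeros
in the set, together with `x`, span the whole span. -/
lemma exists_dual_span_zeros {E : Type*} [AddCommGroup E] [Module ℝ E] (S : Finset E) (x : E)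
    (f : Module.Dual ℝ E) (hf : ∀ s ∈ S, 0 ≤ f s) (hx : f x < 0) :
    ∃ g : Module.Dual ℝ E, (∀ s ∈ S, 0 ≤ g s) ∧ g x < 0 ∧
      Submodule.span ℝ (S : Set E) ≤ Submodule.span ℝ {s ∈ (S : Set E) | g s = 0} ⊔ ℝ ∙ x := by
  classical
  induction h : S.card - (S.filter (f · = 0)).card using Nat.strong_induction_on
    generalizing f with
  | _ n ih =>
  subst h
  by_cases hspan :
      Submodule.span ℝ (S : Set E) ≤ Submodule.span ℝ {s ∈ (S : Set E) | f s = 0} ⊔ ℝ ∙ x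
  · exact ⟨f, hf, hx, hspan⟩
  obtain ⟨s₀, hs₀, hs₀'⟩ : ∃ s ∈ S,
      s ∉ Submodule.span ℝ {s ∈ (S : Set E) | f s = 0} ⊔ ℝ ∙ x := by
    rw [Submodule.span_le, not_subset] at hspan
    exact hspan
  obtain ⟨g, hg, hker⟩ : ∃ g : Module.Dual ℝ E, g s₀ < 0 ∧
      Submodule.span ℝ {s ∈ (S : Set E) | f s = 0} ⊔ ℝ ∙ x ≤ LinearMap.ker g := by
    obtain ⟨g, hg, hker⟩ := Submodule.exists_le_ker_of_notMem hs₀'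
    rcases lt_or_gt_of_ne hg with hg | hg
    · exact ⟨g, hg, hker⟩
    · refine ⟨-g, by simpa using hg, fun y hy => ?_⟩
      simpa using hker hy
  have hgx : g x = 0 :=
    hker (Submodule.mem_sup_right (Submodule.mem_span_singleton_self x))
  have hgT : ∀ s ∈ S, f s = 0 → g s = 0 := fun s hs h =>
    hker (Submodule.mem_sup_left (Submodule.subset_span ⟨hs, h⟩))
  obtain ⟨s₁, hs₁, hmin⟩ := Finset.exists_min_image (S.filter (g · < 0)) (fun s => f s / (-g s))
    ⟨s₀, by simp [hs₀, hg]⟩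
  rw [Finset.mem_filter] at hs₁
  set t := f s₁ / (-g s₁) with ht
  have ht0 : 0 ≤ t := div_nonneg (hf _ hs₁.1) (by linarith [hs₁.2])
  have hs₁0 : f s₁ + t * g s₁ = 0 := by
    have := hs₁.2.ne
    rw [ht]
    field_simp
    ring
  refine ih _ ?_ (f + t • g) ?_ ?_ rfl
  · have hlt : (S.filter (f · = 0)).card < (S.filter ((f + t • g) · = 0)).card := by
      apply Finset.card_lt_card
      rw [Finset.ssubset_iff_of_subset]
      · refine ⟨s₁, by simp [hs₁.1, hs₁0], fun h => ?_⟩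
        have := hgT s₁ hs₁.1 (Finset.mem_filter.1 h).2
        linarith [hs₁.2]
      · intro s hs
        rw [Finset.mem_filter] at hs ⊢
        simp [hs.1, hs.2, hgT s hs.1 hs.2]
    have := Finset.card_filter_le S ((f + t • g) · = 0)
    omega
  · intro s hs
    simp only [LinearMap.add_apply, LinearMap.smul_apply, smul_eq_mul]
    rcases lt_or_ge (g s) 0 with h | h
    · have := hmin s (by simp [hs, h])
      rw [le_div_iff₀ (by linarith)] at this
      linarith
    · exact add_nonneg (hf s hs) (mul_nonneg ht0 h)
  · simpa [hgx] using hx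

/-- Points outside the cone over a compact convex set can be separated from it linearly. -/
lemma exists_dual_neg_of_notMem_cone {N : ℕ} {Q : Set (Fin N → ℝ)} (hQ : IsCompact Q)
    (hconv : Convex ℝ Q) (hne : Q.Nonempty) (x : (Fin N → ℝ) × ℝ)
    (hx : ∀ t : ℝ, 0 ≤ t → ∀ q ∈ Q, x ≠ t • homogenize q) :
    ∃ f : Module.Dual ℝ ((Fin N → ℝ) × ℝ), (∀ q ∈ Q, 0 ≤ f (homogenize q)) ∧ f x < 0 := by
  obtain ⟨y, τ⟩ := x
  rcases lt_trichotomy τ 0 with hτ | rfl | hτ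
  · exact ⟨LinearMap.snd ℝ _ _, fun q _ => by simp [homogenize], by simpa using hτ⟩
  · have hy : y ≠ 0 := by
      rintro rfl
      obtain ⟨q, hq⟩ := hne
      exact hx 0 le_rfl q hq (by simp)
    have hbd : BddAbove ((fun q : Fin N → ℝ => dotProductBilin ℝ ℝ y q) '' Q) :=
      (hQ.image (LinearMap.continuous_of_finiteDimensional (dotProductBilin ℝ ℝ y))).bddAbove
    obtain ⟨M, hM⟩ := hbd
    refine ⟨M • LinearMap.snd ℝ _ _ - (dotProductBilin ℝ ℝ y).comp (LinearMap.fst ℝ _ _),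
      fun q hq => ?_, ?_⟩
    · have := hM (mem_image_of_mem _ hq)
      simpa [homogenize] using this
    · have : 0 < y ⬝ᵥ y :=
        lt_of_le_of_ne (Finset.sum_nonneg fun i _ => mul_self_nonneg _)
          (Ne.symm (dotProduct_self_eq_zero.not.2 hy))
      simpa using this
  · have hmem : τ⁻¹ • y ∉ Q := fun h => hx τ hτ.le _ h (by
      ext <;> simp [homogenize, hτ.ne'])
    obtain ⟨f, u, hf, hu⟩ := geometric_hahn_banach_closed_point hconv hQ.isClosed hmem
    refine ⟨u • LinearMap.snd ℝ _ _ - (f : (Fin N → ℝ) →ₗ[ℝ] ℝ).comp (LinearMap.fst ℝ _ _),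
      fun q hq => ?_, ?_⟩
    · simpa [homogenize] using (hf q hq).le
    · rw [map_smul, smul_eq_mul, ← div_eq_inv_mul, lt_div_iff₀ hτ] at hu
      simpa using hu

lemma injOn_inter_facets {N : ℕ} (S : Set (Fin N → ℝ)) :
    InjOn (· ∩ S) {F | IsFacetOf F (convexHull ℝ S)} := by
  intro F hF G hG h
  rw [hF.1.eq_convexHull_inter, hG.1.eq_convexHull_inter]
  exact congrArg _ h

lemma finite_facets {N : ℕ} {S : Set (Fin N → ℝ)} (hS : S.Finite) :
    {F | IsFacetOf F (convexHull ℝ S)}.Finite :=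
  Finite.of_finite_image (hS.finite_subsets.subset (by
    rintro _ ⟨F, -, rfl⟩
    exact inter_subset_right)) (injOn_inter_facets S)

lemma dual_nonneg_convexHull {N : ℕ} {S : Set (Fin N → ℝ)}
    {g : Module.Dual ℝ ((Fin N → ℝ) × ℝ)} (hg : ∀ s ∈ S, 0 ≤ g (homogenize s)) :
    ∀ q ∈ convexHull ℝ S, 0 ≤ g (homogenize q) := by
  refine convexHull_min (t := {q | 0 ≤ g (homogenize q)}) hg ?_
  intro x hx y hy a b ha hb hab
  rw [mem_ofPred_eq] at hx hy ⊢
  rw [homogenize_combo x y hab, map_add, map_smul, map_smul]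
  exact add_nonneg (mul_nonneg ha hx) (mul_nonneg hb hy)

/-- A point of the linear span of the homogenization of a polytope satisfying all facet
inequalities lies in the cone over the polytope. -/
lemma mem_cone_of_facet_nonneg {N : ℕ} {Q : Set (Fin N → ℝ)} (hQ : IsPolytope Q)
    (hne : Q.Nonempty) (f : {F // IsFacetOf F Q} → Module.Dual ℝ ((Fin N → ℝ) × ℝ))
    (hf : ∀ F, ∀ q ∈ Q, 0 ≤ f F (homogenize q))
    (hfF : ∀ F, F.1 = {q ∈ Q | f F (homogenize q) = 0})
    {x : (Fin N → ℝ) × ℝ} (hx : x ∈ Submodule.span ℝ (homogenize '' Q))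
    (hfx : ∀ F, 0 ≤ f F x) :
    ∃ t : ℝ, 0 ≤ t ∧ ∃ q ∈ Q, x = t • homogenize q := by
  classical
  obtain ⟨S, hQ⟩ := hQ
  by_contra! hcon
  obtain ⟨g₀, hg₀, hg₀x⟩ := exists_dual_neg_of_notMem_cone
    (hQ ▸ S.finite_toSet.isCompact_convexHull (𝕜 := ℝ)) (hQ ▸ convex_convexHull ℝ _) hne x hcon
  have hSQ : (S : Set (Fin N → ℝ)) ⊆ Q := hQ ▸ subset_convexHull ℝ _
  obtain ⟨g, hg, hgx, hspan⟩ := exists_dual_span_zeros (S.image homogenize) x g₀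
    (by
      intro s hs
      obtain ⟨q, hq, rfl⟩ := Finset.mem_image.1 hs
      exact hg₀ q (hSQ hq)) hg₀x
  have hgQ := dual_nonneg_convexHull (S := (S : Set (Fin N → ℝ))) (g := g)
    fun s hs => hg _ (Finset.mem_image_of_mem _ hs)
  rw [← hQ] at hgQ
  set V := Submodule.span ℝ (homogenize '' Q) with hV
  set F : Set (Fin N → ℝ) := {q ∈ Q | g (homogenize q) = 0} with hF
  set A := Submodule.span ℝ (homogenize '' F) with hA
  have hAV : A ⊔ ℝ ∙ x = V := by
    apply le_antisymm
    · exact sup_le (Submodule.span_mono (image_mono (sep_subset _ _)))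
        ((Submodule.span_singleton_le_iff_mem _ _).2 hx)
    · rw [hV, hQ, span_homogenize_convexHull, ← Finset.coe_image]
      refine hspan.trans (sup_le_sup_right (Submodule.span_mono ?_) _)
      rintro s ⟨hs, hs0⟩
      obtain ⟨q, hq, rfl⟩ := Finset.mem_image.1 hs
      exact mem_image_of_mem _ ⟨hSQ hq, hs0⟩
  have hAg : A ≤ LinearMap.ker g := by
    rw [hA, Submodule.span_le]
    rintro _ ⟨q, hq, rfl⟩
    exact hq.2
  have hrank : Module.finrank ℝ A + 1 = Module.finrank ℝ V := by
    rw [← hAV, Submodule.finrank_sup_span_singleton fun h => hgx.ne (hAg h)]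
  have hfacet : IsFacetOf F Q := isFacetOf_iff.2 ⟨isFaceOf_iff.2 ⟨g, hgQ, rfl⟩, hrank⟩
  have hFA : A ≤ LinearMap.ker (f ⟨F, hfacet⟩) := by
    rw [hA, Submodule.span_le]
    rintro _ ⟨q, hq, rfl⟩
    have hq' : q ∈ (⟨F, hfacet⟩ : {F // IsFacetOf F Q}).1 := hq
    rw [hfF] at hq'
    exact hq'.2
  have hall : F = Q := by
    refine Subset.antisymm (sep_subset _ _) fun q hq => ?_
    have hqV : homogenize q ∈ A ⊔ ℝ ∙ x := hAV ▸ Submodule.subset_span (mem_image_of_mem _ hq)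
    obtain ⟨a, ha, y, hy, hay⟩ := Submodule.mem_sup.1 hqV
    obtain ⟨μ, rfl⟩ := Submodule.mem_span_singleton.1 hy
    have h1 := hgQ q hq
    have h2 := hf ⟨F, hfacet⟩ q hq
    have ha1 : g a = 0 := hAg ha
    have ha2 : f ⟨F, hfacet⟩ a = 0 := hFA ha
    rw [← hay, map_add, map_smul, smul_eq_mul, ha1, zero_add] at h1
    have hμ : μ ≤ 0 := by
      by_contra! hμ
      linarith [mul_neg_of_pos_of_neg hμ hgx]
    have h3 : f ⟨F, hfacet⟩ (homogenize q) = 0 := by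
      refine le_antisymm ?_ h2
      rw [← hay, map_add, map_smul, smul_eq_mul, ha2, zero_add]
      exact mul_nonpos_of_nonpos_of_nonneg hμ (hfx _)
    have hmem : q ∈ (⟨F, hfacet⟩ : {F // IsFacetOf F Q}).1 := by
      rw [hfF]
      exact ⟨hq, h3⟩
    exact hmem
  have := hfacet.2
  rw [hall] at this
  omega

/-- A nonempty polytope of dimension `d` has at least `d + 1` facets, and in the case of equality
it is the convex hull of `d + 1` points. -/
lemma pdim_lt_facetCount {N : ℕ} {Q : Set (Fin N → ℝ)} (hQ : IsPolytope Q) (hne : Q.Nonempty) :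
    pdim Q + 1 ≤ facetCount Q ∧ (pdim Q + 1 = facetCount Q →
      ∃ p : Fin (facetCount Q) → Fin N → ℝ, Q = convexHull ℝ (range p)) := by
  classical
  have hface := fun F : {F // IsFacetOf F Q} => isFaceOf_iff.1 F.2.1
  choose f hf hfF using hface
  have hcone := fun x hx => mem_cone_of_facet_nonneg hQ hne f hf hfF (x := x) hx
  obtain ⟨S, hS⟩ := hQ
  set V := Submodule.span ℝ (homogenize '' Q) with hV
  have hfin : Finite {F // IsFacetOf F Q} := 
    (hS ▸ finite_facets S.finite_toSet : {F | IsFacetOf F Q}.Finite).to_subtype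
  have := Fintype.ofFinite {F // IsFacetOf F Q}
  have hcard : facetCount Q = Fintype.card {F // IsFacetOf F Q} := by
    rw [facetCount, ← Nat.card_coe_set_eq]
    exact Nat.card_eq_fintype_card (α := {F // IsFacetOf F Q})
  set L : V →ₗ[ℝ] ({F // IsFacetOf F Q} → ℝ) := LinearMap.pi fun F => (f F).domRestrict V with hL
  have hLapp : ∀ w F, L w F = f F w := fun w F => rfl
  have hinj : Function.Injective L := by
    rw [injective_iff_map_eq_zero]
    intro w hw
    have hw0 : ∀ F, f F w = 0 := fun F => congrFun hw F
    obtain ⟨t, ht, q, -, hq⟩ := hcone w w.2 fun F => (hw0 F).ge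
    obtain ⟨u, hu, r, -, hr⟩ := hcone (-w) (neg_mem w.2) fun F => by simp [hw0 F]
    have h1 : (w : (Fin N → ℝ) × ℝ).2 = t := by simp [hq, homogenize]
    have h2 : (-w : (Fin N → ℝ) × ℝ).2 = u := by simp [hr, homogenize]
    rw [Prod.snd_neg] at h2
    have ht0 : t = 0 := by linarith
    apply Subtype.ext
    rw [hq, ht0, zero_smul]
    rfl
  rw [pdim_add_one]
  refine ⟨?_, fun heq => ?_⟩
  · have := LinearMap.finrank_le_finrank_of_injective hinj
    rw [Module.finrank_fintype_fun_eq_card, ← hcard] at this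
    exact_mod_cast this
  · have hdim : Module.finrank ℝ V = Module.finrank ℝ ({F // IsFacetOf F Q} → ℝ) := by
      rw [Module.finrank_fintype_fun_eq_card, ← hcard]
      exact_mod_cast heq
    set e := LinearEquiv.ofInjectiveOfFinrankEq L hinj hdim with he
    have heapp : ∀ w, e w = L w := fun w => rfl
    have hvert : ∀ F, ∃ t : ℝ, 0 ≤ t ∧ ∃ q ∈ Q,
        (e.symm (Pi.single F 1) : (Fin N → ℝ) × ℝ) = t • homogenize q := by
      intro F
      refine hcone _ (e.symm (Pi.single F 1)).2 fun G => ?_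
      rw [← hLapp, ← heapp, e.apply_symm_apply]
      rw [Pi.single_apply]
      split_ifs <;> norm_num
    choose t ht q hq hqt using hvert
    refine ⟨q ∘ (Fintype.equivFinOfCardEq hcard.symm).symm, ?_⟩
    rw [EquivLike.range_comp]
    apply Subset.antisymm
    · intro x hx
      set w : V := ⟨homogenize x, Submodule.subset_span (mem_image_of_mem _ hx)⟩ with hw
      have hsum : homogenize x = ∑ F, (f F (homogenize x) * t F) • homogenize (q F) := by
        have h1 : w = ∑ F, L w F • e.symm (Pi.single F 1) := by
          apply e.injective
          rw [map_sum]
          simp only [map_smul, LinearEquiv.apply_symm_apply]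
          rw [heapp]
          exact pi_eq_sum_univ' (L w)
        have h2 := congrArg (Subtype.val : V → _) h1
        simpa [hqt, mul_smul, hLapp, hw] using h2
      refine mem_convexHull_of_exists_fintype (fun F => f F (homogenize x) * t F) q
        (fun F => mul_nonneg (hf F x hx) (ht F)) ?_ (fun F => mem_range_self F) ?_
      · have := congrArg Prod.snd hsum
        simpa [homogenize, Prod.snd_sum] using this.symm
      · have := congrArg Prod.fst hsum
        simpa [homogenize, Prod.fst_sum] using this.symm
    · exact convexHull_min (range_subset_iff.2 hq) (hS ▸ convex_convexHull ℝ _)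

lemma pdim_image_le {M N : ℕ} (π : (Fin M → ℝ) →ᵃ[ℝ] (Fin N → ℝ)) (Q : Set (Fin M → ℝ)) :
    pdim (π '' Q) ≤ pdim Q := by
  unfold pdim
  rcases Q.eq_empty_or_nonempty with rfl | hne
  · simp
  rw [if_pos hne, if_pos (hne.image π), ← AffineSubspace.map_span, AffineSubspace.map_direction]
  exact_mod_cast Submodule.finrank_map_le _ _

/-- A `d`-simplex has at most `d + 1` facets. -/
lemma facetCount_simplex_le {N d : ℕ} {S : Finset (Fin N → ℝ)} (hcard : S.card = d + 1)
    (hS : AffineIndependent ℝ (Subtype.val : {x // x ∈ S} → (Fin N → ℝ)))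
    (hd : pdim (convexHull ℝ (S : Set (Fin N → ℝ))) = d) :
    facetCount (convexHull ℝ (S : Set (Fin N → ℝ))) ≤ d + 1 := by
  classical
  have hmaps : ∀ F ∈ {F | IsFacetOf F (convexHull ℝ (S : Set (Fin N → ℝ)))},
      F ∩ S ∈ (fun T : Finset (Fin N → ℝ) => (T : Set (Fin N → ℝ))) '' S.powersetCard d := by
    intro F hF
    have hcoe : ((S.filter (· ∈ F) : Finset (Fin N → ℝ)) : Set (Fin N → ℝ)) = F ∩ S := by
      ext x
      simp [and_comm]
    refine ⟨S.filter (· ∈ F), ?_, hcoe⟩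
    rw [Finset.mem_coe, Finset.mem_powersetCard]
    refine ⟨Finset.filter_subset _ _, ?_⟩
    have hdim := hF.2
    rw [hF.1.eq_convexHull_inter, hd, ← hcoe] at hdim
    rcases (S.filter (· ∈ F)).eq_empty_or_nonempty with h0 | h0
    · rw [h0] at hdim ⊢
      have : (0 : ℤ) = d := by simpa [pdim] using hdim
      rw [Finset.card_empty]
      exact_mod_cast this
    · have hind : AffineIndependent ℝ
          (Subtype.val : {x // x ∈ S.filter (· ∈ F)} → (Fin N → ℝ)) :=
        hS.mono (s := {x | x ∈ S.filter (· ∈ F)}) (fun x hx => (Finset.mem_filter.1 hx).1)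
      have := h0.to_subtype
      have hrank := hind.finrank_vectorSpan_add_one
      have hne : (convexHull ℝ ((S.filter (· ∈ F) : Finset (Fin N → ℝ)) :
        Set (Fin N → ℝ))).Nonempty := convexHull_nonempty_iff.2 h0
      rw [pdim, if_pos hne, affineSpan_convexHull, direction_affineSpan] at hdim
      rw [Fintype.card_coe] at hrank
      have hr : range (Subtype.val : {x // x ∈ S.filter (· ∈ F)} → (Fin N → ℝ)) =
        ((S.filter (· ∈ F) : Finset (Fin N → ℝ)) : Set (Fin N → ℝ)) := Subtype.range_coe
      rw [hr] at hrank
      omega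
  calc facetCount (convexHull ℝ (S : Set (Fin N → ℝ)))
      ≤ ((fun T : Finset (Fin N → ℝ) => (T : Set (Fin N → ℝ))) '' S.powersetCard d).ncard :=
        ncard_le_ncard_of_injOn _ hmaps (injOn_inter_facets _)
          ((S.powersetCard d).finite_toSet.image _)
    _ ≤ ((S.powersetCard d : Finset _) : Set (Finset (Fin N → ℝ))).ncard :=
        ncard_image_le (Finset.finite_toSet _)
    _ = d + 1 := by
        rw [ncard_coe_finset, Finset.card_powersetCard, hcard, Nat.choose_succ_self_right]

theorem xc_eq_dim_add_one_iff_simplex (N d : ℕ) (P : Set (Fin N → ℝ))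
    (hP : IsPolytope P) (hd : pdim P = d) :
    xc P = d + 1 ↔
      ∃ S : Finset (Fin N → ℝ), S.card = d + 1 ∧
        AffineIndependent ℝ (Subtype.val : {x // x ∈ S} → (Fin N → ℝ)) ∧
        P = convexHull ℝ (S : Set (Fin N → ℝ)) := by
  classical
  have hPne : P.Nonempty := by
    by_contra h
    rw [pdim, if_neg h] at hd
    omega
  set X := {n | ∃ (e : ℕ) (Q : Set (Fin e → ℝ)) (π : (Fin e → ℝ) →ᵃ[ℝ] (Fin N → ℝ)),
    IsPolytope Q ∧ π '' Q = P ∧ facetCount Q = n}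
  have hmem : facetCount P ∈ X := ⟨N, P, AffineMap.id ℝ _, hP, by simp, rfl⟩
  have hxc : xc P ∈ X := Nat.sInf_mem ⟨_, hmem⟩
  obtain ⟨e, Q, π, hQ, hπ, hcount⟩ := hxc
  have hQne : Q.Nonempty := by
    rw [← hπ] at hPne
    exact hPne.of_image
  have hle := pdim_image_le π Q
  rw [hπ, hd] at hle
  obtain ⟨hlow, heq⟩ := pdim_lt_facetCount hQ hQne
  constructor
  · intro h
    rw [h] at hcount
    rw [hcount] at heq hlow
    obtain ⟨p, hp⟩ := heq (by omega)
    have hPp : P = convexHull ℝ (range (π ∘ p)) := by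
      rw [← hπ, hp, AffineMap.image_convexHull, range_comp]
    have hind : AffineIndependent ℝ (π ∘ p) := by
      rw [affineIndependent_iff_le_finrank_vectorSpan ℝ _ (Fintype.card_fin (d + 1))]
      rw [pdim, if_pos hPne, hPp, affineSpan_convexHull, direction_affineSpan] at hd
      omega
    refine ⟨Finset.univ.image (π ∘ p), ?_, ?_, ?_⟩
    · rw [Finset.card_image_of_injective _ hind.injective, Finset.card_fin]
    · have := hind.range
      convert this using 2 <;> simp
    · rw [Finset.coe_image, Finset.coe_univ, image_univ, hPp]
  · rintro ⟨S, hcard, hS, rfl⟩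
    have h1 : xc (convexHull ℝ (S : Set (Fin N → ℝ))) ≤ d + 1 :=
      (Nat.sInf_le hmem).trans (facetCount_simplex_le hcard hS hd)
    omega

end
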